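/- Suppose E[ν ln(ν)] = ∞ and let 1 < a < b < m. Then Σ_{n≥0} P(ν(ξ_n) ∈ (a^n, b^n)) = ∞, where ν(ξ_n) is the number of children of the spine vertex at generation n. Moreover, for all n large enough, P(ν(ξ_n) ∈ (a^n, b^n)) ≥ (1/(2m)) E[ν · 1_{a^n < ν < b^n}]. -/

import Mathlib

open MeasureTheory Filter Set

noncomputable section

/-- A configuration assigns to each Ulam–Harris label (a finite word on `ℕ`)
a number of children. A Galton–Watson tree is encoded by such a configuration. -/
abbrev Config : Type := List ℕ → ℕ

/-- `v` is a vertex of the tree encoded by the configuration `ω`: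
every step of the path from the root is the index of a child of the previous vertex. -/
def memTree (ω : Config) (v : List ℕ) : Prop :=
  ∀ k, (h : k < v.length) → v.get ⟨k, h⟩ < ω (v.take k)

/-- `Z ω u k` is the number of descendants of the vertex `u` at height `|u| + k`
in the tree encoded by `ω`. -/
def Z (ω : Config) (u : List ℕ) (k : ℕ) : ℕ :=
  Nat.card {v : List ℕ // v.length = k ∧ memTree ω (u ++ v)}

/-- `GW` is the law of the Galton–Watson tree with offspring distribution `q`:
under `GW` the numbers of children attached to the distinct labels
are i.i.d. with distribution `q`. -/
def IsGW (q : ℕ → ℝ) (GW : Measure Config) : Prop :=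
  IsProbabilityMeasure GW ∧
    ∀ (S : Finset (List ℕ)) (g : List ℕ → ℕ),
      GW {ω | ∀ u ∈ S, ω u = g u} = ∏ u ∈ S, ENNReal.ofReal (q (g u))

/-- The probability generating function `φ_n(x) = E[x^{Z_n}]` of the population
at height `n` under the measure `GW`. -/
def pgf (GW : Measure Config) (n : ℕ) (x : ℝ) : ℝ :=
  ∫ ω, x ^ (Z ω [] n) ∂GW

/-- The vertex at height `n` of the ray whose successive child choices are given by `ξ`. -/
def rayVertex (ξ : ℕ → ℕ) (n : ℕ) : List ℕ := List.ofFn (fun i : Fin n => ξ i)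

/-- The generation at height `k` of the tree encoded by `t`. -/
def genSet (t : Config) (k : ℕ) : Set (List ℕ) := {v | v.length = k ∧ memTree t v}

/-- The offspring distribution `q̃_ℓ = q_ℓ e^{1/c_k} e^{-ℓ/c_{k+1}}` of a vertex of
generation `k` off the spine. -/
def tq (q : ℕ → ℝ) (c : ℕ → ℝ) (k ℓ : ℕ) : ℝ :=
  q ℓ * Real.exp (1 / c k) * Real.exp (-(ℓ : ℝ) / c (k + 1))

/-- The offspring distribution
`q̃^s_ℓ = q_ℓ ℓ e^{-(ℓ-1)/c_{k+1}} φ'_k(φ_k^{-1}(s)) / φ'_{k+1}(φ_{k+1}^{-1}(s))`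
of the spine vertex `ξ_k` at generation `k`. -/
def tqs (q : ℕ → ℝ) (c : ℕ → ℝ) (GW : Measure Config) (φinv : ℕ → ℝ → ℝ) (s : ℝ)
    (k ℓ : ℕ) : ℝ :=
  q ℓ * (ℓ : ℝ) * Real.exp (-((ℓ : ℝ) - 1) / c (k + 1)) *
    (deriv (pgf GW k) (φinv k s) / deriv (pgf GW (k + 1)) (φinv (k + 1) s))

/-- `P` is the law of the marked tree `(𝕋, ξ)` of the spine construction:
conditionally on the first `k` generations `𝕋_k` and on the spine vertex `ξ_k`, the
numbers of children of the vertices at generation `k` are independent, the spine vertex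
`ξ_k` having `ℓ` children with probability `tqs k ℓ`, every other vertex of generation `k`
having `ℓ` children with probability `tq k ℓ`, and `ξ_{k+1}` is chosen uniformly among the
children of `ξ_k`.  Equivalently, the probability that the tree agrees with `t` up to
generation `n` and that the spine makes the choices `u 0, …, u (n-1)` is the product below. -/
def IsSpineLaw (tq' tqs' : ℕ → ℕ → ℝ) (P : Measure (Config × (ℕ → ℕ))) : Prop :=
  IsProbabilityMeasure P ∧
    ∀ (n : ℕ) (t : Config) (u : ℕ → ℕ), (∀ k < n, u k < t (rayVertex u k)) →
      P {p | (∀ v : List ℕ, v.length < n → memTree t v → p.1 v = t v) ∧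
             (∀ k < n, p.2 k = u k)}
        = ∏ k ∈ Finset.range n,
            ENNReal.ofReal ((tqs' k (t (rayVertex u k)) / (t (rayVertex u k)))
              * ∏ᶠ v ∈ (genSet t k \ {rayVertex u k}), tq' k (t v))


theorem memTree_nil (t : Config) : memTree t [] := by
  intro k h; simp at h

theorem memTree_snoc (t : Config) (v : List ℕ) (j : ℕ) :
    memTree t (v ++ [j]) ↔ memTree t v ∧ j < t v := by
  unfold memTree
  constructor
  · intro h
    refine ⟨fun k hk => ?_, ?_⟩
    · have := h k (by simp; omega)
      simpa [List.getElem_append_left hk, List.take_append_of_le_length hk.le] using this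
    · have := h v.length (by simp)
      simpa using this
  · rintro ⟨h1, h2⟩ k hk
    simp at hk
    rcases Nat.lt_or_ge k v.length with h | h
    · have := h1 k h
      simpa [List.getElem_append_left h, List.take_append_of_le_length h.le] using this
    · have : k = v.length := by omega
      subst this
      simpa using h2

def G (t : Config) : ℕ → Finset (List ℕ)
  | 0 => {[]}
  | n+1 => (G t n).biUnion (fun v => (Finset.range (t v)).image (fun j => v ++ [j]))

theorem mem_G (t : Config) (n : ℕ) (v : List ℕ) : v ∈ G t n ↔ v.length = n ∧ memTree t v := by
  induction n generalizing v with
  | zero =>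
    simp only [G, Finset.mem_singleton, List.length_eq_zero_iff]
    constructor
    · rintro rfl; exact ⟨rfl, memTree_nil t⟩
    · exact fun h => h.1
  | succ n ih =>
    simp only [G, Finset.mem_biUnion, Finset.mem_image, Finset.mem_range]
    constructor
    · rintro ⟨w, hw, j, hj, rfl⟩
      rw [ih] at hw
      rw [memTree_snoc]
      simp [hw.1, hw.2, hj]
    · rintro ⟨h1, h2⟩
      rcases List.eq_nil_or_concat v with rfl | ⟨w, j, rfl⟩
      · simp at h1
      · rw [List.concat_eq_append] at h1 h2 ⊢
        rw [memTree_snoc] at h2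
        refine ⟨w, (ih w).2 ⟨by simpa using h1, h2.1⟩, j, h2.2, rfl⟩

theorem coe_G (t : Config) (n : ℕ) : (G t n : Set (List ℕ)) = genSet t n := by
  ext v; simp [mem_G, genSet]

theorem Z_eq (t : Config) (n : ℕ) : Z t [] n = (G t n).card := by
  unfold Z
  rw [← Nat.card_eq_finsetCard]
  refine Nat.card_congr (Equiv.subtypeEquivRight fun v => ?_)
  simp [mem_G]

theorem card_G_succ (t : Config) (n : ℕ) : (G t (n+1)).card = ∑ v ∈ G t n, t v := by
  rw [G, Finset.card_biUnion]
  · refine Finset.sum_congr rfl fun v _ => ?_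
    rw [Finset.card_image_of_injective]
    · simp
    · intro i j h; simpa using h
  · intro v hv w hw hvw
    rw [Function.onFun, Finset.disjoint_left]
    intro x hx hx'
    simp only [Finset.mem_image] at hx hx'
    obtain ⟨i, _, rfl⟩ := hx
    obtain ⟨j, _, h⟩ := hx'
    apply hvw
    exact (List.append_inj_left' h rfl).symm

def Tr (t : Config) (n : ℕ) : Finset (List ℕ) := (Finset.range n).biUnion (G t)

theorem mem_Tr (t : Config) (n : ℕ) (v : List ℕ) : v ∈ Tr t n ↔ v.length < n ∧ memTree t v := by
  simp [Tr, mem_G]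

theorem Tr_succ (t : Config) (n : ℕ) : Tr t (n+1) = Tr t n ∪ G t n := by
  ext v
  simp only [mem_Tr, Finset.mem_union, mem_G]
  grind

theorem disj_Tr_G (t : Config) (n : ℕ) : Disjoint (Tr t n) (G t n) := by
  rw [Finset.disjoint_left]; intro v; rw [mem_Tr, mem_G]; omega

def Agree (t t' : Config) (n : ℕ) : Prop := ∀ v ∈ Tr t n, t' v = t v

theorem Agree.G_eq {t t' : Config} {n : ℕ} (h : Agree t t' n) {k : ℕ} (hk : k ≤ n) :
    G t' k = G t k := by
  induction k with
  | zero => rfl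
  | succ k ih =>
    rw [G, G, ih (by omega)]
    refine Finset.biUnion_congr rfl fun v hv => ?_
    rw [h v]
    rw [mem_G] at hv
    rw [mem_Tr]; exact ⟨by omega, hv.2⟩

theorem Agree.Tr_eq {t t' : Config} {n : ℕ} (h : Agree t t' n) : Tr t' n = Tr t n := by
  unfold Tr
  exact Finset.biUnion_congr rfl fun k hk => h.G_eq (by simp at hk; omega)

def sig (n : ℕ) (t : Config) : Finset (List ℕ × ℕ) := (Tr t n).image (fun v => (v, t v))

theorem sig_eq_iff (n : ℕ) (t t' : Config) : sig n t' = sig n t ↔ Agree t t' n := by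
  constructor
  · intro h v hv
    have : (v, t v) ∈ sig n t' := by rw [h]; exact Finset.mem_image_of_mem _ hv
    simp only [sig, Finset.mem_image, Prod.mk.injEq] at this
    obtain ⟨w, _, rfl, h2⟩ := this
    exact h2
  · intro h
    unfold sig
    rw [h.Tr_eq]
    exact Finset.image_congr fun v hv => by simp [h v hv]

theorem tsum_prod_fin (h : ℕ → ENNReal) (n : ℕ) :
    ∑' g : Fin n → ℕ, ∏ i, h (g i) = (∑' l, h l) ^ n := by
  induction n with
  | zero => simp
  | succ n ih =>
    rw [← (Fin.consEquiv (fun _ : Fin (n+1) => ℕ)).tsum_eq]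
    simp only [Fin.consEquiv_apply, Fin.prod_univ_succ, Fin.cons_zero, Fin.cons_succ]
    rw [ENNReal.tsum_prod (f := fun (a : ℕ) (b : Fin n → ℕ) => h a * ∏ i, h (b i))]
    simp only [ENNReal.tsum_mul_left, ENNReal.tsum_mul_right]
    rw [ih, pow_succ, mul_comm]

theorem tsum_prod_type {ι : Type*} [Fintype ι] (h : ℕ → ENNReal) :
    ∑' g : ι → ℕ, ∏ i, h (g i) = (∑' l, h l) ^ Fintype.card ι := by
  rw [← tsum_prod_fin, ← (Equiv.arrowCongr (Fintype.equivFin ι) (Equiv.refl ℕ)).tsum_eq]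
  refine tsum_congr fun g => ?_
  rw [← (Fintype.equivFin ι).prod_comp]
  simp

theorem measurableSet_eval {ι : Type*} (S : Set ι) [hS : Countable S] (g : ι → ℕ) :
    MeasurableSet {ω : ι → ℕ | ∀ u ∈ S, ω u = g u} := by
  have : {ω : ι → ℕ | ∀ u ∈ S, ω u = g u} = ⋂ u : S, (fun ω => ω u.1) ⁻¹' {g u} := by
    ext; simp
  rw [this]
  exact MeasurableSet.iInter fun u => (measurable_pi_apply u.1) (MeasurableSet.singleton _)

theorem measurable_sig (n : ℕ) : @Measurable _ _ _ ⊤ (sig n) := by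
  refine @measurable_to_countable' _ _ ⊤ _ _ _ fun S => ?_
  by_cases h : ∃ t, sig n t = S
  · obtain ⟨t, rfl⟩ := h
    have : sig n ⁻¹' {sig n t} = {ω | ∀ u ∈ (Tr t n : Set (List ℕ)), ω u = t u} := by
      ext ω; simp [sig_eq_iff, Agree]
    rw [this]
    exact measurableSet_eval _ t
  · convert MeasurableSet.empty
    ext ω
    simp only [mem_preimage, mem_singleton_iff, mem_empty_iff_false, iff_false]
    exact fun h' => h ⟨_, h'⟩

theorem measurable_cardG (n : ℕ) : Measurable (fun t => (G t n).card) := by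
  refine measurable_to_countable' fun k => ?_
  have : (fun t => (G t n).card) ⁻¹' {k} = sig n ⁻¹' (sig n '' ((fun t => (G t n).card) ⁻¹' {k})) := by
    refine Subset.antisymm (subset_preimage_image _ _) ?_
    rintro t ⟨t', h1, h2⟩
    rw [sig_eq_iff] at h2
    simp only [mem_preimage, mem_singleton_iff] at h1 ⊢
    rw [← h1, h2.G_eq le_rfl]
  rw [this]
  exact @measurable_sig n _ trivial

theorem lint_cyl (q : ℕ → ℝ) (GW : Measure Config) (hGW : IsGW q GW) (n : ℕ) (t : Config)
    (y : ENNReal) :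
    ∫⁻ ω in sig n ⁻¹' {sig n t}, y ^ (G ω (n+1)).card ∂GW
      = ∫⁻ ω in sig n ⁻¹' {sig n t}, (∑' l, ENNReal.ofReal (q l) * y ^ l) ^ (G ω n).card ∂GW := by
  classical
  have hms : ∀ n t, MeasurableSet (sig n ⁻¹' {sig n t}) := fun n t => @measurable_sig n _ trivial
  have hR : ∫⁻ ω in sig n ⁻¹' {sig n t}, (∑' l, ENNReal.ofReal (q l) * y ^ l) ^ (G ω n).card ∂GW
      = (∑' l, ENNReal.ofReal (q l) * y ^ l) ^ (G t n).card * GW (sig n ⁻¹' {sig n t}) := by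
    rw [← setLIntegral_const]
    refine setLIntegral_congr_fun (hms n t) fun ω hω => ?_
    simp only [mem_preimage, mem_singleton_iff, sig_eq_iff] at hω
    simp only [hω.G_eq le_rfl]
  let A : (G t n → ℕ) → Set Config := fun g =>
    {ω | ∀ u ∈ Tr t n ∪ G t n, ω u = if h : u ∈ G t n then g ⟨u, h⟩ else t u}
  have hA : ∀ g, GW (A g) = GW (sig n ⁻¹' {sig n t}) * ∏ v, ENNReal.ofReal (q (g v)) := by
    intro g
    have h1 : sig n ⁻¹' {sig n t} = {ω | ∀ u ∈ Tr t n, ω u = t u} := by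
      ext ω; simp [sig_eq_iff, Agree]
    rw [h1, hGW.2, hGW.2, Finset.prod_union (disj_Tr_G t n)]
    congr 1
    · refine Finset.prod_congr rfl fun v hv => ?_
      rw [dif_neg (Finset.disjoint_left.1 (disj_Tr_G t n) hv)]
    · rw [← Finset.prod_coe_sort]
      refine Finset.prod_congr rfl fun v _ => ?_
      rw [dif_pos v.2]
  have hAm : ∀ g, MeasurableSet (A g) := fun g => by
    have := measurableSet_eval ((Tr t n ∪ G t n : Finset _) : Set (List ℕ))
      (fun u => if h : u ∈ G t n then g ⟨u, h⟩ else t u)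
    simpa only [Finset.mem_coe] using this
  have hU : sig n ⁻¹' {sig n t} = ⋃ g, A g := by
    ext ω
    simp only [mem_preimage, mem_singleton_iff, sig_eq_iff, mem_iUnion, A, mem_ofPred_eq]
    constructor
    · intro h
      refine ⟨fun v => ω v, fun u hu => ?_⟩
      split_ifs with h'
      · rfl
      · exact h u (by simpa [h'] using hu)
    · rintro ⟨g, hg⟩ v hv
      rw [hg v (by simp [hv]), dif_neg (Finset.disjoint_left.1 (disj_Tr_G t n) hv)]
  have hD : Pairwise (Function.onFun Disjoint A) := by
    intro g g' hgg
    rw [Function.onFun, Set.disjoint_left]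
    intro ω h1 h2
    apply hgg
    funext v
    have a1 := h1 v (by simp)
    have a2 := h2 v (by simp)
    rw [dif_pos v.2] at a1 a2
    exact a1.symm.trans a2
  rw [hR]
  conv_lhs => rw [hU]
  rw [lintegral_iUnion hAm hD]
  have : ∀ g, ∫⁻ ω in A g, y ^ (G ω (n+1)).card ∂GW
      = GW (sig n ⁻¹' {sig n t}) * ∏ v, (ENNReal.ofReal (q (g v)) * y ^ (g v)) := by
    intro g
    rw [Finset.prod_mul_distrib, ← mul_assoc, ← hA, mul_comm, ← setLIntegral_const]
    refine setLIntegral_congr_fun (hAm g) fun ω hω => ?_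
    have hag : Agree t ω n := by
      have : ω ∈ sig n ⁻¹' {sig n t} := by rw [hU]; exact mem_iUnion.2 ⟨g, hω⟩
      simpa [sig_eq_iff] using this
    rw [card_G_succ, hag.G_eq le_rfl, Finset.prod_pow_eq_pow_sum, ← Finset.sum_coe_sort]
    congr 1
    refine Finset.sum_congr rfl fun v _ => ?_
    rw [hω v (by simp), dif_pos v.2]
  simp only [this]
  rw [ENNReal.tsum_mul_left, tsum_prod_type (fun l => ENNReal.ofReal (q l) * y ^ l), mul_comm]
  simp

theorem lint_succ (q : ℕ → ℝ) (GW : Measure Config) (hGW : IsGW q GW) (n : ℕ) 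
    (y : ENNReal) :
    ∫⁻ ω, y ^ (G ω (n+1)).card ∂GW
      = ∫⁻ ω, (∑' l, ENNReal.ofReal (q l) * y ^ l) ^ (G ω n).card ∂GW := by
  have hU : (univ : Set Config) = ⋃ S, sig n ⁻¹' {S} := by ext; simp
  have hms : ∀ S, MeasurableSet (sig n ⁻¹' {S}) := fun t => @measurable_sig n _ trivial
  have hD : Pairwise (Function.onFun Disjoint fun S => sig n ⁻¹' {S}) := by
    intro S S' h
    rw [Function.onFun, Set.disjoint_left]
    rintro x rfl h2
    exact h h2
  rw [← setLIntegral_univ, ← setLIntegral_univ (μ := GW), hU, lintegral_iUnion hms hD,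
    lintegral_iUnion hms hD]
  refine tsum_congr fun S => ?_
  by_cases h : ∃ t, sig n t = S
  · obtain ⟨t, rfl⟩ := h
    exact lint_cyl q GW hGW n t y
  · have : sig n ⁻¹' {S} = ∅ := by
      ext ω
      simp only [mem_preimage, mem_singleton_iff, mem_empty_iff_false, iff_false]
      exact fun h' => h ⟨_, h'⟩
    simp [this]

theorem pgf_eq (GW : Measure Config) (n : ℕ) {x : ℝ} (hx : 0 ≤ x) :
    pgf GW n x = (∫⁻ ω, (ENNReal.ofReal x) ^ (G ω n).card ∂GW).toReal := by
  unfold pgf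
  simp only [Z_eq]
  rw [integral_eq_lintegral_of_nonneg_ae]
  · simp only [ENNReal.ofReal_pow hx]
  · exact Eventually.of_forall fun ω => pow_nonneg hx _
  · exact ((measurable_of_countable (fun k : ℕ => x ^ k)).comp (measurable_cardG n)).aestronglyMeasurable

def phi (q : ℕ → ℝ) (x : ℝ) : ℝ := ∑' l, q l * x ^ l

theorem summ_phi (q : ℕ → ℝ) (hq : ∀ l, 0 ≤ q l) (hs : Summable q) {x : ℝ} (h0 : 0 ≤ x)
    (h1 : x ≤ 1) : Summable (fun l => q l * x ^ l) :=
  Summable.of_nonneg_of_le (fun l => mul_nonneg (hq l) (pow_nonneg h0 _))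
    (fun l => mul_le_of_le_one_right (hq l) (pow_le_one₀ h0 h1)) hs

theorem pgf_zero (q : ℕ → ℝ) (GW : Measure Config) (hGW : IsGW q GW) (x : ℝ) :
    pgf GW 0 x = x := by
  have := hGW.1
  unfold pgf
  simp [Z_eq, G]

theorem pgf_succ (q : ℕ → ℝ) (hq : ∀ l, 0 ≤ q l) (hs : Summable q) 
    (GW : Measure Config) (hGW : IsGW q GW) (n : ℕ) {x : ℝ} (h0 : 0 ≤ x) (h1 : x ≤ 1) :
    pgf GW (n+1) x = pgf GW n (phi q x) := by
  rw [pgf_eq _ _ h0, pgf_eq, lint_succ q GW hGW]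
  · congr 3
    funext ω
    congr 1
    rw [phi, ENNReal.ofReal_tsum_of_nonneg _ (summ_phi q hq hs h0 h1)]
    · simp only [ENNReal.ofReal_mul (hq _), ENNReal.ofReal_pow h0]
    · exact fun l => mul_nonneg (hq l) (pow_nonneg h0 _)
  · exact tsum_nonneg fun l => mul_nonneg (hq l) (pow_nonneg h0 _)

theorem ray_length (u : ℕ → ℕ) (n : ℕ) : (rayVertex u n).length = n := by
  simp [rayVertex]

theorem ray_succ (u : ℕ → ℕ) (n : ℕ) : rayVertex u (n+1) = rayVertex u n ++ [u n] := by
  unfold rayVertex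
  rw [List.ofFn_succ']
  simp

theorem ray_congr {u u' : ℕ → ℕ} {n : ℕ} (h : ∀ k < n, u' k = u k) :
    rayVertex u' n = rayVertex u n := by
  unfold rayVertex
  congr 1
  funext i
  exact h i i.2

theorem ray_mem {t : Config} {u : ℕ → ℕ} {n : ℕ} (h : ∀ k < n, u k < t (rayVertex u k)) :
    memTree t (rayVertex u n) := by
  induction n with
  | zero => exact memTree_nil t
  | succ n ih =>
    rw [ray_succ, memTree_snoc]
    exact ⟨ih fun k hk => h k (by omega), h n (by omega)⟩

def cyl (n : ℕ) (t : Config) (u : ℕ → ℕ) : Set (Config × (ℕ → ℕ)) :=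
  {p | (∀ v : List ℕ, v.length < n → memTree t v → p.1 v = t v) ∧ (∀ k < n, p.2 k = u k)}

theorem mem_cyl {n : ℕ} {t : Config} {u : ℕ → ℕ} {p : Config × (ℕ → ℕ)} :
    p ∈ cyl n t u ↔ Agree t p.1 n ∧ ∀ k < n, p.2 k = u k := by
  simp [cyl, Agree, mem_Tr]

theorem cyl_meas (n : ℕ) (t : Config) (u : ℕ → ℕ) : MeasurableSet (cyl n t u) := by
  have : cyl n t u = Prod.fst ⁻¹' {ω | ∀ v ∈ (Tr t n : Set (List ℕ)), ω v = t v} ∩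
      Prod.snd ⁻¹' {x | ∀ k ∈ (Finset.range n : Set ℕ), x k = u k} := by
    ext p; simp [mem_cyl, Agree]
  rw [this]
  exact (measurable_fst (measurableSet_eval _ t)).inter (measurable_snd (measurableSet_eval _ u))

def Val (n : ℕ) (p : Config × (ℕ → ℕ)) : Prop := ∀ k < n, p.2 k < p.1 (rayVertex p.2 k)

theorem cyl_val {n : ℕ} {t : Config} {u : ℕ → ℕ} {p : Config × (ℕ → ℕ)}
    (hp : p ∈ cyl n t u) (hv : Val n (t, u)) : Val n p := by
  rw [mem_cyl] at hp
  intro k hk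
  rw [hp.2 k hk, ray_congr (fun j hj => hp.2 j (by omega)), hp.1]
  · exact hv k hk
  · rw [mem_Tr, ray_length]
    exact ⟨hk, ray_mem fun j hj => hv j (by omega)⟩

/-- one step of the spine law -/
theorem spine_step (tq' tqs' : ℕ → ℕ → ℝ) (P : Measure (Config × (ℕ → ℕ)))
    (hP : IsSpineLaw tq' tqs' P) (h0 : ∀ k l, 0 ≤ tq' k l)
    (h1 : ∀ k, ∑' l, ENNReal.ofReal (tq' k l) = 1) (n : ℕ) (t : Config) (u : ℕ → ℕ)
    (hv : Val n (t, u)) (l : ℕ) (hl : l ≠ 0) :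
    P (cyl n t u) * ENNReal.ofReal (tqs' n l) ≤
      P (cyl n t u ∩ {p | p.1 (rayVertex p.2 n) = l ∧ p.2 n < l}) := by
  classical
  set r := rayVertex u n with hr
  have hrG : r ∈ G t n := by rw [mem_G]; exact ⟨ray_length _ _, ray_mem hv⟩
  let F := (G t n).erase r
  let T : (F → ℕ) → Config := fun g v =>
    if v = r then l else if h : v ∈ F then g ⟨v, h⟩ else t v
  let U : Fin l → ℕ → ℕ := fun j => Function.update u n j
  have hTr : ∀ g, T g r = l := fun g => by simp [T]
  have hTF : ∀ g (v : F), T g v = g v := fun g v => by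
    have h1 : (v : List ℕ) ≠ r := (Finset.mem_erase.1 v.2).1
    simp only [T]
    rw [if_neg h1, dif_pos v.2]
  have hTlt : ∀ g v, v.length ≠ n → T g v = t v := fun g v hvn => by
    have h1 : v ≠ r := by rintro rfl; exact hvn (ray_length _ _)
    have h2 : v ∉ F := fun h => hvn ((mem_G _ _ _).1 (Finset.mem_erase.1 h).2).1
    simp only [T]
    rw [if_neg h1, dif_neg h2]
  have hTA : ∀ g, Agree t (T g) n := fun g v hvT => by
    rw [mem_Tr] at hvT
    exact hTlt g v (by omega)
  have hUlt : ∀ j k, k < n → U j k = u k := fun j k hk => by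
    simp only [U]; rw [Function.update_of_ne (by omega)]
  have hUn : ∀ j, U j n = j := fun j => by simp [U]
  have hray : ∀ j k, k ≤ n → rayVertex (U j) k = rayVertex u k := fun j k hk =>
    ray_congr fun i hi => hUlt j i (by omega)
  have hval : ∀ g j, Val (n+1) (T g, U j) := by
    intro g j k hk
    simp only
    rw [hray j k (by omega)]
    rcases Nat.lt_succ_iff_lt_or_eq.1 hk with hk | rfl
    · rw [hUlt j k hk, hTlt g _ (by rw [ray_length]; omega)]
      exact hv k hk
    · rw [hUn, ← hr, hTr]; exact j.2
  have hPc : ∀ g j, P (cyl (n+1) (T g) (U j)) =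
      P (cyl n t u) * (ENNReal.ofReal (tqs' n l / l) * ∏ v, ENNReal.ofReal (tq' n (g v))) := by
    intro g j
    have e1 := hP.2 (n+1) (T g) (U j) (hval g j)
    have e2 := hP.2 n t u hv
    change P (cyl (n+1) (T g) (U j)) = _ at e1
    change P (cyl n t u) = _ at e2
    rw [e1, e2, Finset.prod_range_succ]
    congr 1
    · refine Finset.prod_congr rfl fun k hk => ?_
      rw [Finset.mem_range] at hk
      rw [hray j k hk.le, hTlt g _ (by rw [ray_length]; omega), ← coe_G, ← coe_G,
        (hTA g).G_eq hk.le]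
      congr 2
      refine finprod_mem_congr rfl fun v hv => ?_
      rw [hTlt]
      have := hv.1
      rw [coe_G] at this
      have := this.1
      omega
    · rw [hray j n le_rfl, ← hr, hTr, ← coe_G, (hTA g).G_eq le_rfl, ENNReal.ofReal_mul']
      · congr 1
        rw [← Finset.coe_erase, finprod_mem_coe_finset, ENNReal.ofReal_prod_of_nonneg (fun _ _ => h0 _ _),
          ← Finset.prod_coe_sort]
        refine Finset.prod_congr rfl fun v _ => ?_
        rw [hTF]
      · exact finprod_nonneg fun v => finprod_nonneg fun _ => h0 _ _
  have hsub : (⋃ x : (F → ℕ) × Fin l, cyl (n+1) (T x.1) (U x.2)) ⊆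
      cyl n t u ∩ {p | p.1 (rayVertex p.2 n) = l ∧ p.2 n < l} := by
    refine iUnion_subset ?_
    rintro ⟨g, j⟩ p hp
    rw [mem_cyl] at hp
    obtain ⟨ha, hb⟩ := hp
    simp only at ha hb
    have hT : Tr (T g) n = Tr t n := (hTA g).Tr_eq
    have hG : G (T g) n = G t n := (hTA g).G_eq le_rfl
    have hb' : ∀ k < n, p.2 k = u k := fun k hk => by rw [hb k (by omega), hUlt j k hk]
    refine ⟨mem_cyl.2 ⟨fun v hv => ?_, hb'⟩, ?_, ?_⟩
    · rw [ha v (by rw [Tr_succ, hT]; simp [hv]), hTA g v hv]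
    · rw [ray_congr hb', ← hr, ha r (by rw [Tr_succ, hG]; simp [hrG]), hTr]
    · rw [hb n (by omega), hUn]; exact j.2
  have hdisj : Pairwise (Function.onFun Disjoint fun x : (F → ℕ) × Fin l => cyl (n+1) (T x.1) (U x.2)) := by
    rintro ⟨g, j⟩ ⟨g', j'⟩ hne
    rw [Function.onFun, Set.disjoint_left]
    intro p hp hp'
    rw [mem_cyl] at hp hp'
    apply hne
    have hj : j = j' := by
      have a1 := hp.2 n (by omega)
      have a2 := hp'.2 n (by omega)
      simp only [hUn] at a1 a2
      exact Fin.ext (a1.symm.trans a2)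
    have hg : g = g' := by
      funext v
      have hvG : (v : List ℕ) ∈ G t n := (Finset.mem_erase.1 v.2).2
      have a1 := hp.1 v (by rw [Tr_succ, (hTA g).G_eq le_rfl]; simp [hvG])
      have a2 := hp'.1 v (by rw [Tr_succ, (hTA g').G_eq le_rfl]; simp [hvG])
      simp only [hTF] at a1 a2
      exact a1.symm.trans a2
    rw [hj, hg]
  refine le_trans (le_of_eq ?_) (measure_mono hsub)
  rw [measure_iUnion hdisj fun x => cyl_meas _ _ _]
  simp only [hPc]
  rw [ENNReal.tsum_mul_left, ENNReal.tsum_prod (f := fun (g : F → ℕ) (_ : Fin l) =>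
    ENNReal.ofReal (tqs' n l / l) * ∏ v, ENNReal.ofReal (tq' n (g v)))]
  congr 1
  have hl' : (0:ℝ) < l := by positivity
  simp only [tsum_fintype, Finset.sum_const, Finset.card_univ, Fintype.card_fin, nsmul_eq_mul]
  rw [ENNReal.tsum_mul_left, ENNReal.tsum_mul_left, tsum_prod_type (fun i => ENNReal.ofReal (tq' n i)),
    h1, one_pow, mul_one, ← ENNReal.ofReal_natCast, ← ENNReal.ofReal_mul hl'.le]
  congr 1
  field_simp

theorem cyl_glue (P : Measure (Config × (ℕ → ℕ))) (n : ℕ) (E : Set (Config × (ℕ → ℕ)))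
    (hE : MeasurableSet E) (κ : ENNReal)
    (h : ∀ t u, Val n (t, u) → P (cyl n t u) * κ ≤ P (cyl n t u ∩ E)) :
    P {p | Val n p} * κ ≤ P ({p | Val n p} ∩ E) := by
  let f : Config × (ℕ → ℕ) → Finset (List ℕ × ℕ) × List ℕ := fun p => (sig n p.1, rayVertex p.2 n)
  have hf : ∀ p, Val n p → {p | Val n p} ∩ f ⁻¹' {f p} = cyl n p.1 p.2 := by
    intro p hp
    ext p'
    rw [mem_cyl]
    simp only [f, mem_inter_iff, mem_preimage, mem_singleton_iff, Prod.mk.injEq, sig_eq_iff,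
      mem_ofPred_eq]
    constructor
    · rintro ⟨-, h1, h2⟩
      refine ⟨h1, fun k hk => ?_⟩
      unfold rayVertex at h2
      have := congrFun (List.ofFn_injective h2) ⟨k, hk⟩
      exact this
    · rintro ⟨h1, h2⟩
      exact ⟨cyl_val (mem_cyl.2 ⟨h1, h2⟩) hp, h1, ray_congr h2⟩
  have hf' : ∀ x, ({p | Val n p} ∩ f ⁻¹' {x} = ∅) ∨ ∃ t u, Val n (t, u) ∧
      {p | Val n p} ∩ f ⁻¹' {x} = cyl n t u := by
    intro x
    rcases Set.eq_empty_or_nonempty ({p | Val n p} ∩ f ⁻¹' {x}) with h | ⟨p, hp, rfl⟩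
    · exact Or.inl h
    · exact Or.inr ⟨p.1, p.2, hp, hf p hp⟩
  have hm : ∀ x, MeasurableSet ({p | Val n p} ∩ f ⁻¹' {x}) := by
    intro x
    rcases hf' x with h | ⟨t, u, -, h⟩ <;> rw [h]
    · exact MeasurableSet.empty
    · exact cyl_meas _ _ _
  have hU : {p | Val n p} = ⋃ x, ({p | Val n p} ∩ f ⁻¹' {x}) := by
    ext p; simp
  have hd : Pairwise (Function.onFun Disjoint fun x => ({p | Val n p} ∩ f ⁻¹' {x})) := by
    intro x y hxy
    rw [Function.onFun, Set.disjoint_left]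
    rintro p ⟨-, rfl⟩ ⟨-, h⟩
    exact hxy h
  rw [hU, iUnion_inter, measure_iUnion hd hm, measure_iUnion _ (fun x => (hm x).inter hE)]
  · rw [← ENNReal.tsum_mul_right]
    refine ENNReal.tsum_le_tsum fun x => ?_
    rcases hf' x with h' | ⟨t, u, hv, h'⟩ <;> rw [h']
    · simp
    · exact h t u hv
  · intro x y hxy
    exact (hd hxy).mono inter_subset_left inter_subset_left

theorem ev_meas (n : ℕ) : Measurable (fun p : Config × (ℕ → ℕ) => p.1 (rayVertex p.2 n)) := by
  have h1 : @Measurable _ _ _ ⊤ (fun p : Config × (ℕ → ℕ) => rayVertex p.2 n) := by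
    refine @measurable_to_countable' _ _ ⊤ _ _ _ fun w => ?_
    have : (fun p : Config × (ℕ → ℕ) => rayVertex p.2 n) ⁻¹' {w} =
      (fun p : Config × (ℕ → ℕ) => fun i : Fin n => p.2 i) ⁻¹' {g | List.ofFn g = w} := rfl
    rw [this]
    refine measurableSet_preimage (by fun_prop) (Set.to_countable _).measurableSet
  refine measurable_to_countable' fun k => ?_
  have : (fun p : Config × (ℕ → ℕ) => p.1 (rayVertex p.2 n)) ⁻¹' {k} =
    ⋃ w, (fun p : Config × (ℕ → ℕ) => rayVertex p.2 n) ⁻¹' {w} ∩ {p | p.1 w = k} := by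
    ext p; simp
  rw [this]
  refine MeasurableSet.iUnion fun w => (@h1 _ trivial).inter ?_
  exact measurableSet_eq_fun (by fun_prop) measurable_const

theorem spine_lower (tq' tqs' : ℕ → ℕ → ℝ) (P : Measure (Config × (ℕ → ℕ)))
    (hP : IsSpineLaw tq' tqs' P) (h0 : ∀ k l, 0 ≤ tq' k l)
    (h1 : ∀ k, ∑' l, ENNReal.ofReal (tq' k l) = 1)
    (hs0 : ∀ k, tqs' k 0 = 0)
    (hs1 : ∀ k, ∑' l, ENNReal.ofReal (tqs' k l) = 1) (n : ℕ) (S : Set ℕ) :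
    ∑' l, S.indicator (fun l => ENNReal.ofReal (tqs' n l)) l
      ≤ P {p | p.1 (rayVertex p.2 n) ∈ S} := by
  have hprob := hP.1
  have key : ∀ n (S : Set ℕ), P {p | Val n p} * ∑' l, S.indicator (fun l => ENNReal.ofReal (tqs' n l)) l
      ≤ P ({p | Val n p} ∩ {p | p.1 (rayVertex p.2 n) ∈ S ∧ p.2 n < p.1 (rayVertex p.2 n)}) := by
    intro n S
    refine cyl_glue P n _ ?_ _ fun t u hv => ?_
    · exact ((ev_meas n) (Set.to_countable S).measurableSet).inter
        (measurableSet_lt ((measurable_pi_apply n).comp measurable_snd) (ev_meas n))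
    · rw [← ENNReal.tsum_mul_left]
      have hEm : ∀ l, MeasurableSet {p : Config × (ℕ → ℕ) | p.1 (rayVertex p.2 n) = l ∧ p.2 n < l} := fun l =>
        (measurableSet_eq_fun (ev_meas n) measurable_const).inter
          (measurableSet_lt ((measurable_pi_apply n).comp measurable_snd) measurable_const)
      have : ∀ l, P (cyl n t u) * S.indicator (fun l => ENNReal.ofReal (tqs' n l)) l ≤
          P (cyl n t u ∩ {p | l ∈ S ∧ p.1 (rayVertex p.2 n) = l ∧ p.2 n < l}) := by
        intro l
        by_cases hl : l ∈ S
        · rw [indicator_of_mem hl]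
          simp only [hl, true_and]
          rcases eq_or_ne l 0 with rfl | hl0
          · simp [hs0]
          · exact spine_step tq' tqs' P hP h0 h1 n t u hv l hl0
        · simp [hl]
      refine (ENNReal.tsum_le_tsum this).trans ?_
      rw [← measure_iUnion]
      · refine measure_mono (iUnion_subset ?_)
        rintro l p ⟨hp, hl, rfl, h⟩
        exact ⟨hp, hl, h⟩
      · intro i j hij
        rw [Function.onFun, Set.disjoint_left]
        rintro p ⟨-, -, rfl, -⟩ ⟨-, -, h, -⟩
        exact hij h
      · intro l
        refine (cyl_meas n t u).inter ?_
        by_cases hl : l ∈ S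
        · simpa [hl] using hEm l
        · simp [hl]
  have hV : ∀ n, P {p | Val n p} = 1 := by
    intro n
    induction n with
    | zero => simp [Val]
    | succ n ih =>
      have := key n univ
      rw [ih] at this
      simp only [indicator_univ, hs1, one_mul] at this
      refine le_antisymm prob_le_one (this.trans (measure_mono ?_))
      rintro p ⟨h1, -, h2⟩ k hk
      rcases Nat.lt_succ_iff_lt_or_eq.1 hk with hk | rfl
      · exact h1 k hk
      · exact h2
  have := key n S
  rw [hV, one_mul] at this
  exact this.trans (measure_mono fun p hp => hp.2.1)

def dphi (q : ℕ → ℝ) (x : ℝ) : ℝ := ∑' l, q l * (l * x ^ (l - 1))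

theorem summ_dphi (q : ℕ → ℝ) (hq : ∀ l, 0 ≤ q l) (hm : Summable fun l : ℕ => (l : ℝ) * q l) {x : ℝ}
    (h0 : 0 ≤ x) (h1 : x ≤ 1) : Summable (fun l : ℕ => q l * (l * x ^ (l - 1))) :=
  Summable.of_nonneg_of_le (fun l => mul_nonneg (hq l) (by positivity))
    (fun l => by
      have := pow_le_one₀ (n := l - 1) h0 h1
      have h2 : 0 ≤ (l : ℝ) * q l := mul_nonneg (by positivity) (hq l)
      nlinarith) hm

theorem dphi_le (q : ℕ → ℝ) (hq : ∀ l, 0 ≤ q l) (hm : Summable fun l : ℕ => (l : ℝ) * q l) {x : ℝ}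
    (h0 : 0 ≤ x) (h1 : x ≤ 1) : dphi q x ≤ ∑' l : ℕ, (l : ℝ) * q l := by
  refine Summable.tsum_le_tsum (fun l => ?_) (summ_dphi q hq hm h0 h1) hm
  have := pow_le_one₀ (n := l - 1) h0 h1
  have h2 : 0 ≤ (l : ℝ) * q l := mul_nonneg (by positivity) (hq l)
  nlinarith

theorem phi_deriv (q : ℕ → ℝ) (hq : ∀ l, 0 ≤ q l) (hs : Summable q)
    (hm : Summable fun l : ℕ => (l : ℝ) * q l) {x : ℝ}
    (h0 : 0 < x) (h1 : x < 1) : HasDerivAt (phi q) (dphi q x) x := by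
  refine hasDerivAt_tsum_of_isPreconnected (u := fun l : ℕ => (l : ℝ) * q l)
    (g := fun l x => q l * x ^ l) (g' := fun l x => q l * (l * x ^ (l - 1)))
    (t := Ioo 0 1) (y₀ := x) hm isOpen_Ioo isPreconnected_Ioo ?_ ?_ ⟨h0, h1⟩
    (summ_phi q hq hs h0.le h1.le) ⟨h0, h1⟩
  · intro l y _
    exact (hasDerivAt_pow l y).const_mul _
  · intro l y hy
    have := pow_le_one₀ (n := l - 1) hy.1.le hy.2.le
    have h3 := pow_nonneg hy.1.le (l - 1)
    have h2 : 0 ≤ (l : ℝ) * q l := mul_nonneg (by positivity) (hq l)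
    rw [Real.norm_of_nonneg (mul_nonneg (hq l) (by positivity))]
    nlinarith

theorem exists_big (q : ℕ → ℝ) (hq : ∀ l, 0 ≤ q l) (hq0 : q 0 = 0) (hsum : ∑' l, q l = 1)
    (hs : Summable q) (hm : 1 < ∑' l : ℕ, (l : ℝ) * q l) : q 1 < 1 := by
  by_contra! h
  have hz : ∀ l, l ≠ 1 → q l = 0 := by
    intro l hl
    have := hs.sum_le_tsum {1, l} (fun i _ => hq i)
    rw [Finset.sum_pair hl.symm, hsum] at this
    linarith [hq l]
  rw [tsum_eq_single 1 (fun l hl => by simp [hz l hl])] at hm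
  have := hs.sum_le_tsum {1} (fun i _ => hq i)
  simp [hsum] at this hm
  linarith

/-- `φ x ≤ q₁ x + (1 - q₁) x²` -/
theorem phi_le (q : ℕ → ℝ) (hq : ∀ l, 0 ≤ q l) (hq0 : q 0 = 0) (hsum : ∑' l, q l = 1)
    (hs : Summable q) {x : ℝ} (h0 : 0 ≤ x) (h1 : x ≤ 1) :
    phi q x ≤ q 1 * x + (1 - q 1) * x ^ 2 := by
  have hs1 := summ_phi q hq hs h0 h1
  have e1 : HasSum (fun l => q l * x ^ 2 + (if l = 1 then q 1 * (x - x ^ 2) else 0))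
      (1 * x ^ 2 + q 1 * (x - x ^ 2)) := by
    refine HasSum.add ?_ (hasSum_ite_eq 1 _)
    rw [← hsum]
    exact hs.hasSum.mul_right _
  have := hasSum_le (fun l => ?_) hs1.hasSum e1
  · unfold phi; linarith
  · split_ifs with h
    · subst h; simp; linarith
    · rcases eq_or_ne l 0 with rfl | h'
      · simp [hq0]
      · have : x ^ l ≤ x ^ 2 := pow_le_pow_of_le_one h0 h1 (by omega)
        have := mul_le_mul_of_nonneg_left this (hq l)
        linarith

theorem phi_mem (q : ℕ → ℝ) (hq : ∀ l, 0 ≤ q l) (hq0 : q 0 = 0) (hsum : ∑' l, q l = 1)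
    (hs : Summable q) {x : ℝ} (hx : x ∈ Ioo (0:ℝ) 1) : phi q x ∈ Ioo (0:ℝ) 1 := by
  have h := phi_le q hq hq0 hsum hs hx.1.le hx.2.le
  have hq1 : q 1 ≤ 1 := by
    have := hs.sum_le_tsum {1} (fun i _ => hq i)
    simpa [hsum] using this
  obtain ⟨a, b⟩ := hx
  constructor
  · obtain ⟨l, hl⟩ : ∃ l, q l ≠ 0 := by
      by_contra! h; simp [h] at hsum
    have hl' : 0 < q l := lt_of_le_of_ne (hq l) hl.symm
    exact (summ_phi q hq hs a.le b.le).tsum_pos (fun l => mul_nonneg (hq l) (by positivity)) l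
      (by positivity)
  · have : q 1 * x + (1 - q 1) * x ^ 2 ≤ x := by
      nlinarith [mul_nonneg (mul_nonneg (sub_nonneg.2 hq1) a.le) (sub_nonneg.2 b.le)]
    linarith

theorem dphi_pos (q : ℕ → ℝ) (hq : ∀ l, 0 ≤ q l) (hq0 : q 0 = 0) (hsum : ∑' l, q l = 1)
    (hm : Summable fun l : ℕ => (l : ℝ) * q l)
    {x : ℝ} (hx : x ∈ Ioo (0:ℝ) 1) : 0 < dphi q x := by
  obtain ⟨l, hl⟩ : ∃ l, q l ≠ 0 := by
    by_contra! h; simp [h] at hsum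
  have hl' : 0 < q l := lt_of_le_of_ne (hq l) hl.symm
  have hl0 : l ≠ 0 := by rintro rfl; exact hl hq0
  have : (0:ℝ) < l := by positivity
  obtain ⟨a, b⟩ := hx
  exact (summ_dphi q hq hm a.le b.le).tsum_pos (fun l => mul_nonneg (hq l) (by positivity)) l
      (by positivity)

/-- quantitative differentiability at 1 -/
theorem phi_near (q : ℕ → ℝ) (hq : ∀ l, 0 ≤ q l) (hsum : ∑' l, q l = 1)
    (hs : Summable q) (hm : Summable fun l : ℕ => (l : ℝ) * q l) (β : ℝ) (hβ0 : 0 < β)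
    (hβ : β < ∑' l : ℕ, (l : ℝ) * q l) :
    ∃ N : ℕ, ∃ M : ℝ, β < M ∧ ∀ x : ℝ, 0 ≤ x → x ≤ 1 → x ^ N * M * (1 - x) ≤ 1 - phi q x := by
  obtain ⟨N, hN⟩ := ((hm.hasSum.tendsto_sum_nat).eventually (lt_mem_nhds hβ)).exists
  refine ⟨N, _, hN, fun x h0 h1 => ?_⟩
  have e1 : HasSum (fun l => q l - q l * x ^ l) (1 - phi q x) := by
    have := hs.hasSum.sub (summ_phi q hq hs h0 h1).hasSum
    rwa [hsum] at this
  have e2 : ∀ l, 0 ≤ q l - q l * x ^ l := fun l => by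
    have := pow_le_one₀ (n := l) h0 h1
    nlinarith [hq l]
  refine le_trans ?_ (sum_le_hasSum (Finset.range N) (fun l _ => e2 l) e1)
  rw [Finset.mul_sum, Finset.sum_mul]
  refine Finset.sum_le_sum fun l hl => ?_
  rw [Finset.mem_range] at hl
  have e3 : (l : ℝ) * x ^ N ≤ ∑ i ∈ Finset.range l, x ^ i := by
    rw [← nsmul_eq_mul]
    have := Finset.card_nsmul_le_sum (Finset.range l) (fun i => x ^ i) (x ^ N) (fun i hi => by
      rw [Finset.mem_range] at hi
      exact pow_le_pow_of_le_one h0 h1 (by omega))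
    simpa using this
  have e4 := geom_sum_mul x l
  have e5 : q l - q l * x ^ l = q l * ((∑ i ∈ Finset.range l, x ^ i) * (1 - x)) := by
    linear_combination q l * e4
  rw [e5]
  calc x ^ N * (l * q l) * (1 - x) = q l * ((l * x ^ N) * (1 - x)) := by ring
    _ ≤ _ := by
      refine mul_le_mul_of_nonneg_left (mul_le_mul_of_nonneg_right e3 (by linarith)) (hq l)

theorem theta_lim (q : ℕ → ℝ) (hq : ∀ l, 0 ≤ q l) (hq0 : q 0 = 0) (hsum : ∑' l, q l = 1)
    (hs : Summable q) (hm : Summable fun l : ℕ => (l : ℝ) * q l) 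
    (hm1 : 1 < ∑' l : ℕ, (l : ℝ) * q l) (b : ℝ) (hb1 : 1 < b) (hb : b < ∑' l : ℕ, (l : ℝ) * q l)
    (θ : ℕ → ℝ) (hθ : ∀ n, θ n ∈ Ioo (0:ℝ) 1) (hrec : ∀ n, phi q (θ (n+1)) = θ n) :
    ∀ᶠ n : ℕ in atTop, b ^ n * (1 - θ (n+1)) ≤ 1 / 2 := by
  have hq1 := exists_big q hq hq0 hsum hs hm1
  have step : ∀ n, (1 - θ (n+1)) * (1 + (1 - q 1) * θ (n+1)) ≤ 1 - θ n := by
    intro n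
    have := phi_le q hq hq0 hsum hs (hθ (n+1)).1.le (hθ (n+1)).2.le
    rw [hrec] at this
    nlinarith
  have mono : Monotone θ := monotone_nat_of_le_succ fun n => by
    have := step n
    have h1 := (hθ (n+1)).1
    have h2 := (hθ (n+1)).2
    have : 0 ≤ (1 - θ (n+1)) * ((1 - q 1) * θ (n+1)) :=
      mul_nonneg (by linarith) (mul_nonneg (by linarith) h1.le)
    nlinarith
  set h := 1 + (1 - q 1) * θ 0 with hh
  have hh1 : 1 < h := by
    have := mul_pos (sub_pos.2 hq1) (hθ 0).1
    linarith
  have bound : ∀ n, 1 - θ n ≤ (1 - θ 0) * (h⁻¹) ^ n := by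
    intro n
    induction n with
    | zero => simp
    | succ n ih =>
      have s1 := step n
      have s2 : h ≤ 1 + (1 - q 1) * θ (n+1) := by
        have := mul_le_mul_of_nonneg_left (mono (Nat.zero_le (n+1))) (sub_pos.2 hq1).le
        linarith
      have s3 : (1 - θ (n+1)) * h ≤ 1 - θ n :=
        (mul_le_mul_of_nonneg_left s2 (by linarith [(hθ (n+1)).2])).trans s1
      rw [pow_succ, ← mul_assoc, ← div_eq_mul_inv, le_div_iff₀ (by linarith)]
      linarith
  have hlim : Tendsto θ atTop (nhds 1) := by
    have t1 : Tendsto (fun n => (1 - θ 0) * (h⁻¹) ^ n) atTop (nhds 0) := by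
      have := (tendsto_pow_atTop_nhds_zero_of_lt_one (inv_nonneg.2 (by linarith : 0 ≤ h))
        (inv_lt_one_of_one_lt₀ hh1)).const_mul (1 - θ 0)
      simpa using this
    have t2 : Tendsto (fun n => 1 - θ n) atTop (nhds 0) :=
      squeeze_zero (fun n => by linarith [(hθ n).2]) bound t1
    have := t2.const_sub 1
    simpa using this
  obtain ⟨β, hβ1, hβ2⟩ := exists_between hb
  obtain ⟨N, M, hM, hphi⟩ := phi_near q hq hsum hs hm β (by linarith) hβ2
  have hev : ∀ᶠ n in atTop, β < θ n ^ N * M := by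
    have : Tendsto (fun n => θ n ^ N * M) atTop (nhds M) := by
      simpa using (hlim.pow N).mul_const M
    exact this.eventually (lt_mem_nhds hM)
  obtain ⟨n0, hn0⟩ := eventually_atTop.1 hev
  have step2 : ∀ n ≥ n0, β * (1 - θ (n+1)) ≤ 1 - θ n := by
    intro n hn
    have a1 := hphi (θ (n+1)) (hθ _).1.le (hθ _).2.le
    rw [hrec] at a1
    have a2 := hn0 (n+1) (by omega)
    have a3 := mul_le_mul_of_nonneg_right a2.le (by linarith [(hθ (n+1)).2] : 0 ≤ 1 - θ (n+1))
    linarith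
  have bound2 : ∀ k, β ^ k * (1 - θ (n0 + k)) ≤ 1 := by
    intro k
    induction k with
    | zero => simp; linarith [(hθ n0).1]
    | succ k ih =>
      have a1 := step2 (n0 + k) (by omega)
      have a2 := mul_le_mul_of_nonneg_left a1 (pow_nonneg (by linarith : 0 ≤ β) k)
      rw [pow_succ, ← add_assoc]
      linarith
  have t3 : Tendsto (fun k : ℕ => b ^ n0 * (b / β) ^ k) atTop (nhds 0) := by
    have := (tendsto_pow_atTop_nhds_zero_of_lt_one (r := b / β) (div_nonneg (by linarith) (by linarith))
        ((div_lt_one (by linarith)).2 hβ1)).const_mul (b ^ n0)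
    simpa using this
  have t4 := t3.eventually (gt_mem_nhds (by norm_num : (0:ℝ) < 1/2))
  obtain ⟨k0, hk0⟩ := eventually_atTop.1 t4
  refine eventually_atTop.2 ⟨n0 + k0, fun n hn => ?_⟩
  obtain ⟨k, rfl⟩ := Nat.exists_eq_add_of_le (show n0 ≤ n by omega)
  have hk := hk0 k (by omega)
  have hβp : (0:ℝ) < β ^ k := pow_pos (by linarith) k
  have b1 : 1 - θ (n0 + k + 1) ≤ 1 / β ^ k := by
    have := mono (Nat.le_succ (n0 + k))
    have := bound2 k
    rw [le_div_iff₀ hβp]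
    nlinarith
  calc b ^ (n0 + k) * (1 - θ (n0 + k + 1)) ≤ b ^ (n0 + k) * (1 / β ^ k) := by gcongr
    _ = b ^ n0 * (b / β) ^ k := by rw [div_pow, pow_add]; ring
    _ ≤ 1 / 2 := hk.le

theorem pgf_deriv (q : ℕ → ℝ) (hq : ∀ l, 0 ≤ q l) (hq0 : q 0 = 0) (hsum : ∑' l, q l = 1)
    (hs : Summable q) (hm : Summable fun l : ℕ => (l : ℝ) * q l)
    (GW : Measure Config) (hGW : IsGW q GW) (n : ℕ) :
    ∀ x ∈ Ioo (0:ℝ) 1, 0 < deriv (pgf GW n) x ∧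
      deriv (pgf GW (n+1)) x = deriv (pgf GW n) (phi q x) * dphi q x := by
  have hev : ∀ n, ∀ x ∈ Ioo (0:ℝ) 1, pgf GW (n+1) =ᶠ[nhds x] pgf GW n ∘ phi q := by
    intro n x hx
    filter_upwards [Ioo_mem_nhds hx.1 hx.2] with y hy
    exact pgf_succ q hq hs GW hGW n hy.1.le hy.2.le
  have main : ∀ n, ∀ x ∈ Ioo (0:ℝ) 1, 0 < deriv (pgf GW n) x ∧ DifferentiableAt ℝ (pgf GW n) x := by
    intro n
    induction n with
    | zero =>
      intro x hx
      have : pgf GW 0 = fun x => x := funext fun x => pgf_zero q GW hGW x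
      rw [this]
      simp
    | succ n ih =>
      intro x hx
      have hp := ih _ (phi_mem q hq hq0 hsum hs hx)
      have hd := hp.2.hasDerivAt.comp x (phi_deriv q hq hs hm hx.1 hx.2)
      have hd' := hd.congr_of_eventuallyEq (hev n x hx)
      refine ⟨?_, hd'.differentiableAt⟩
      rw [hd'.deriv]
      exact mul_pos hp.1 (dphi_pos q hq hq0 hsum hm hx)
  intro x hx
  refine ⟨(main n x hx).1, ?_⟩
  have hp := main n _ (phi_mem q hq hq0 hsum hs hx)
  have hd := hp.2.hasDerivAt.comp x (phi_deriv q hq hs hm hx.1 hx.2)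
  exact (hd.congr_of_eventuallyEq (hev n x hx)).deriv

theorem count_window (a b : ℝ) (ha : 1 < a) (hab : a < b) (l : ℕ) :
    ENNReal.ofReal ((1 / Real.log a - 1 / Real.log b) * Real.log l) ≤
      (∑' n : ℕ, if a ^ n < (l : ℝ) ∧ (l : ℝ) < b ^ n then (1 : ENNReal) else 0) + 1 := by
  rcases Nat.eq_zero_or_pos l with rfl | hl
  · simp
  have hla : 0 < Real.log a := Real.log_pos ha
  have hlb : 0 < Real.log b := Real.log_pos (ha.trans hab)
  have hl' : (1:ℝ) ≤ l := by exact_mod_cast hl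
  have hll : 0 ≤ Real.log l := Real.log_nonneg hl'
  set x := Real.log l / Real.log b with hx
  set y := Real.log l / Real.log a with hy
  have hx0 : 0 ≤ x := by positivity
  have hsub : ∀ n ∈ Finset.Ico (⌊x⌋₊ + 1) ⌈y⌉₊, a ^ n < (l : ℝ) ∧ (l : ℝ) < b ^ n := by
    intro n hn
    rw [Finset.mem_Ico] at hn
    have n1 : x < n := by
      have := Nat.lt_floor_add_one x
      have h2 : ((⌊x⌋₊ + 1 : ℕ) : ℝ) ≤ n := by exact_mod_cast hn.1
      push_cast at h2
      linarith
    have n2 : (n : ℝ) < y := Nat.lt_ceil.1 hn.2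
    rw [hx, div_lt_iff₀ hlb] at n1
    rw [hy, lt_div_iff₀ hla] at n2
    constructor
    · rw [← Real.log_lt_log_iff (by positivity) (by linarith), Real.log_pow]; exact n2
    · rw [← Real.log_lt_log_iff (by linarith) (pow_pos (by linarith) _), Real.log_pow]; exact n1
  have h1 : ((Finset.Ico (⌊x⌋₊ + 1) ⌈y⌉₊).card : ENNReal) ≤
      ∑' n : ℕ, if a ^ n < (l : ℝ) ∧ (l : ℝ) < b ^ n then (1 : ENNReal) else 0 := by
    refine le_trans (le_of_eq ?_) (ENNReal.sum_le_tsum (Finset.Ico (⌊x⌋₊ + 1) ⌈y⌉₊))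
    rw [Finset.sum_congr rfl (fun n hn => if_pos (hsub n hn))]
    simp
  refine le_trans ?_ (add_le_add h1 le_rfl)
  rw [Nat.card_Ico, ← Nat.cast_one (R := ENNReal), ← Nat.cast_add, ← ENNReal.ofReal_natCast]
  apply ENNReal.ofReal_le_ofReal
  have c1 : y ≤ ⌈y⌉₊ := Nat.le_ceil y
  have c2 : (⌊x⌋₊ : ℝ) ≤ x := Nat.floor_le hx0
  have c3 : ((⌈y⌉₊ : ℕ) : ℝ) ≤ ((⌈y⌉₊ - (⌊x⌋₊ + 1) + 1 : ℕ) : ℝ) + ⌊x⌋₊ := by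
    rw [← Nat.cast_add]
    exact_mod_cast (by omega)
  have : (1 / Real.log a - 1 / Real.log b) * Real.log l = y - x := by rw [hx, hy]; ring
  rw [this]
  linarith

/-- Suppose `E[ν ln ν] = ∞` and let `1 < a < b < m`. Then under the law `P` of the spine
construction, `Σ_n P(ν(ξ_n) ∈ (a^n, b^n)) = ∞`, where `ν(ξ_n)` is the number of children
of the spine vertex at generation `n`; moreover for all `n` large enough,
`P(ν(ξ_n) ∈ (a^n, b^n)) ≥ (1/(2m)) E[ν · 1_{a^n < ν < b^n}]`. -/
theorem spine_offspring_in_window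
    (q : ℕ → ℝ) (hq_nonneg : ∀ ℓ, 0 ≤ q ℓ) (hq_zero : q 0 = 0) (hq_sum : ∑' ℓ, q ℓ = 1)
    (m : ℝ) (hm_def : m = ∑' ℓ : ℕ, (ℓ : ℝ) * q ℓ) (hm_one : 1 < m)
    (GW : Measure Config) (hGW : IsGW q GW)
    (s : ℝ) (hs : s ∈ Set.Ioo (0 : ℝ) 1)
    (φinv : ℕ → ℝ → ℝ)
    (hφinv : ∀ n, ∀ x ∈ Set.Ioo (0 : ℝ) 1,
      φinv n x ∈ Set.Ioo (0 : ℝ) 1 ∧ pgf GW n (φinv n x) = x)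
    (hφinv_left : ∀ n, ∀ y ∈ Set.Ioo (0 : ℝ) 1, φinv n (pgf GW n y) = y)
    (c : ℕ → ℝ) (hc : ∀ n, c n = -1 / Real.log (φinv n s))
    (P : Measure (Config × (ℕ → ℕ)))
    (hP : IsSpineLaw (tq q c) (tqs q c GW φinv s) P)
    (hXlogX : ∑' ℓ : ℕ, ENNReal.ofReal (q ℓ * (ℓ : ℝ) * Real.log ℓ) = ⊤)
    (a b : ℝ) (ha : 1 < a) (hab : a < b) (hbm : b < m) :
    (∑' n : ℕ,
        P {p | a ^ n < (p.1 (rayVertex p.2 n) : ℝ) ∧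
               (p.1 (rayVertex p.2 n) : ℝ) < b ^ n} = ⊤) ∧
    (∀ᶠ n : ℕ in Filter.atTop,
      ENNReal.ofReal ((1 / (2 * m)) *
          ∑' ℓ : ℕ, Set.indicator {ℓ : ℕ | a ^ n < (ℓ : ℝ) ∧ (ℓ : ℝ) < b ^ n}
            (fun ℓ => (ℓ : ℝ) * q ℓ) ℓ)
        ≤ P {p | a ^ n < (p.1 (rayVertex p.2 n) : ℝ) ∧
                 (p.1 (rayVertex p.2 n) : ℝ) < b ^ n}) := by
  have hs' := hs
  clear hs
  have hs : Summable q := by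
    by_contra h
    rw [tsum_eq_zero_of_not_summable h] at hq_sum
    exact zero_ne_one hq_sum
  have hm : Summable fun l : ℕ => (l : ℝ) * q l := by
    by_contra h
    rw [tsum_eq_zero_of_not_summable h] at hm_def
    linarith
  set θ : ℕ → ℝ := fun n => φinv n s with hθdef
  have hθ : ∀ n, θ n ∈ Ioo (0:ℝ) 1 := fun n => (hφinv n s hs').1
  have hrec : ∀ n, phi q (θ (n+1)) = θ n := by
    intro n
    have h1 := (hφinv (n+1) s hs').2
    rw [pgf_succ q hq_nonneg hs GW hGW n (hθ (n+1)).1.le (hθ (n+1)).2.le] at h1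
    have h2 := hφinv_left n _ (phi_mem q hq_nonneg hq_zero hq_sum hs (hθ (n+1)))
    rw [← h2]
    simp only [hθdef]
    rw [h1]
  have hcinv : ∀ n, 1 / c n = - Real.log (θ n) := by
    intro n; rw [hc n, one_div_div]; simp only [hθdef]; ring
  have htq : ∀ k l, tq q c k l = (θ k)⁻¹ * (q l * θ (k+1) ^ l) := by
    intro k l
    have e : -(l : ℝ) / c (k+1) = l * Real.log (θ (k+1)) := by
      rw [div_eq_mul_one_div, hcinv]; ring
    rw [tq, e, hcinv, Real.exp_neg, Real.exp_log (hθ k).1, ← Real.log_pow,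
      Real.exp_log (pow_pos (hθ (k+1)).1 l)]
    ring
  have hdpos : ∀ k, 0 < dphi q (θ k) := fun k => dphi_pos q hq_nonneg hq_zero hq_sum hm (hθ k)
  have htqs : ∀ k l, tqs q c GW φinv s k l = (dphi q (θ (k+1)))⁻¹ * (q l * (l * θ (k+1) ^ (l - 1))) := by
    intro k l
    rcases Nat.eq_zero_or_pos l with rfl | hl
    · simp [tqs]
    have e : -((l : ℝ) - 1) / c (k+1) = (l - 1 : ℕ) * Real.log (θ (k+1)) := by
      rw [div_eq_mul_one_div, hcinv]; push_cast [hl]; ring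
    have hD := pgf_deriv q hq_nonneg hq_zero hq_sum hs hm GW hGW k
    have h1 := (hD _ (hθ (k+1))).2
    have h2 := (hD _ (hθ k)).1
    rw [hrec] at h1
    change deriv (pgf GW (k+1)) (φinv (k+1) s) = deriv (pgf GW k) (φinv k s) * _ at h1
    change 0 < deriv (pgf GW k) (φinv k s) at h2
    have h3 := hdpos (k+1)
    rw [tqs, e, h1, ← Real.log_pow, Real.exp_log (pow_pos (hθ (k+1)).1 _)]
    field_simp
  have hlow := fun n S => spine_lower (tq q c) (tqs q c GW φinv s) P hP
    (fun k l => by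
      rw [htq]
      exact mul_nonneg (inv_nonneg.2 (hθ k).1.le)
        (mul_nonneg (hq_nonneg l) (pow_nonneg (hθ (k+1)).1.le _)))
    (fun k => by
      have hsu := summ_phi q hq_nonneg hs (hθ (k+1)).1.le (hθ (k+1)).2.le
      simp only [htq]
      rw [← ENNReal.ofReal_tsum_of_nonneg _ (hsu.mul_left _), tsum_mul_left]
      · have := hrec k
        unfold phi at this
        rw [this, inv_mul_cancel₀ (hθ k).1.ne']
        simp
      · exact fun l => mul_nonneg (inv_nonneg.2 (hθ k).1.le)
          (mul_nonneg (hq_nonneg l) (pow_nonneg (hθ (k+1)).1.le _)))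
    (fun k => by simp [htqs])
    (fun k => by
      have hsu := summ_dphi q hq_nonneg hm (hθ (k+1)).1.le (hθ (k+1)).2.le
      simp only [htqs]
      rw [← ENNReal.ofReal_tsum_of_nonneg _ (hsu.mul_left _), tsum_mul_left]
      · have := hdpos (k+1)
        change ENNReal.ofReal ((dphi q (θ (k+1)))⁻¹ * dphi q (θ (k+1))) = 1
        rw [inv_mul_cancel₀ this.ne']
        simp
      · have := hdpos (k+1)
        have h2 := (hθ (k+1)).1
        exact fun l => mul_nonneg (inv_nonneg.2 this.le)
          (mul_nonneg (hq_nonneg l) (by positivity))) n S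
  have hW : ∀ n : ℕ, ENNReal.ofReal ((1 / (2 * m)) *
          ∑' ℓ : ℕ, Set.indicator {ℓ : ℕ | a ^ n < (ℓ : ℝ) ∧ (ℓ : ℝ) < b ^ n}
            (fun ℓ => (ℓ : ℝ) * q ℓ) ℓ) = 
      ∑' l, Set.indicator {ℓ : ℕ | a ^ n < (ℓ : ℝ) ∧ (ℓ : ℝ) < b ^ n}
        (fun l => ENNReal.ofReal (1 / (2 * m) * (l * q l))) l := by
    intro n
    rw [← tsum_mul_left, ENNReal.ofReal_tsum_of_nonneg _ ((hm.indicator _).mul_left _)]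
    · refine tsum_congr fun l => ?_
      simp only [Set.indicator_apply]
      split_ifs <;> simp
    · intro l
      refine mul_nonneg (by positivity) (Set.indicator_nonneg (fun l _ => ?_) _)
      exact mul_nonneg (by positivity) (hq_nonneg l)
  have hsecond : ∀ᶠ n : ℕ in Filter.atTop,
      ENNReal.ofReal ((1 / (2 * m)) *
          ∑' ℓ : ℕ, Set.indicator {ℓ : ℕ | a ^ n < (ℓ : ℝ) ∧ (ℓ : ℝ) < b ^ n}
            (fun ℓ => (ℓ : ℝ) * q ℓ) ℓ)
        ≤ P {p | a ^ n < (p.1 (rayVertex p.2 n) : ℝ) ∧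
                 (p.1 (rayVertex p.2 n) : ℝ) < b ^ n} := by
    filter_upwards [theta_lim q hq_nonneg hq_zero hq_sum hs hm (hm_def ▸ hm_one) b (ha.trans hab)
      (hm_def ▸ hbm) θ hθ hrec] with n hn
    refine le_trans ?_ (hlow n {ℓ : ℕ | a ^ n < (ℓ : ℝ) ∧ (ℓ : ℝ) < b ^ n})
    rw [hW]
    refine ENNReal.tsum_le_tsum fun l => ?_
    refine Set.indicator_le_indicator' fun hl => ENNReal.ofReal_le_ofReal ?_
    rw [htqs]
    obtain ⟨hl1, hl2⟩ := hl
    obtain ⟨t0, t1⟩ := hθ (n+1)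
    have hpow : 1 / 2 ≤ θ (n+1) ^ (l - 1) := by
      have b1 := one_add_mul_le_pow (a := θ (n+1) - 1) (by linarith) (l - 1)
      have b2 : ((l - 1 : ℕ) : ℝ) ≤ b ^ n := by
        refine le_trans ?_ hl2.le
        exact_mod_cast Nat.sub_le l 1
      have b3 := mul_le_mul_of_nonneg_right b2 (sub_nonneg.2 t1.le)
      have b4 : 1 + (θ (n+1) - 1) = θ (n+1) := by ring
      rw [b4] at b1
      linarith
    have hd := dphi_le q hq_nonneg hm t0.le t1.le
    rw [← hm_def] at hd
    have hinv : m⁻¹ ≤ (dphi q (θ (n+1)))⁻¹ := inv_anti₀ (hdpos _) hd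
    have hql := hq_nonneg l
    have hlq : 0 ≤ (l : ℝ) * q l := by positivity
    calc 1 / (2 * m) * (l * q l) = m⁻¹ * ((l * q l) * (1 / 2)) := by field_simp
      _ ≤ (dphi q (θ (n+1)))⁻¹ * ((l * q l) * θ (n+1) ^ (l - 1)) := by
        refine mul_le_mul hinv (mul_le_mul_of_nonneg_left hpow hlq) (by positivity)
          (inv_nonneg.2 (hdpos _).le)
      _ = _ := by ring
  refine ⟨?_, hsecond⟩
  have hla : 0 < Real.log a := Real.log_pos ha
  have hκ : 0 < 1 / Real.log a - 1 / Real.log b := 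
    sub_pos.2 (one_div_lt_one_div_of_lt hla (Real.log_lt_log (by linarith) hab))
  set κ := 1 / Real.log a - 1 / Real.log b with hκdef
  set w : ℕ → ENNReal := fun l => ENNReal.ofReal (1 / (2 * m) * (l * q l)) with hw
  set e : ℕ → ENNReal := fun n => ENNReal.ofReal ((1 / (2 * m)) *
          ∑' ℓ : ℕ, Set.indicator {ℓ : ℕ | a ^ n < (ℓ : ℝ) ∧ (ℓ : ℝ) < b ^ n}
            (fun ℓ => (ℓ : ℝ) * q ℓ) ℓ) with he
  have hm0 : 0 < 1 / (2 * m) := by positivity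
  have hwfin : ∑' l, w l ≠ ⊤ := by
    rw [hw, ← ENNReal.ofReal_tsum_of_nonneg _ (hm.mul_left _)]
    · exact ENNReal.ofReal_ne_top
    · exact fun l => mul_nonneg hm0.le (mul_nonneg (by positivity) (hq_nonneg l))
  have hsumtop : ∑' n, e n = ⊤ := by
    have h1 : ∑' n, e n = ∑' l, w l *
        ∑' n : ℕ, if a ^ n < (l : ℝ) ∧ (l : ℝ) < b ^ n then (1 : ENNReal) else 0 := by
      simp only [he, hW, ← ENNReal.tsum_mul_left]
      rw [ENNReal.tsum_comm]
      refine tsum_congr fun l => tsum_congr fun n => ?_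
      simp [Set.indicator_apply, hw]
    have h2 : ∑' l : ℕ, w l * ENNReal.ofReal (κ * Real.log l) ≤ ∑' n, e n + ∑' l, w l := by
      rw [h1, ← ENNReal.tsum_add]
      refine ENNReal.tsum_le_tsum fun l => ?_
      refine (mul_le_mul_right (count_window a b ha hab l) (w l)).trans ?_
      rw [mul_add, mul_one]
    have h3 : ∑' l : ℕ, w l * ENNReal.ofReal (κ * Real.log l) = ⊤ := by
      have : ∀ l : ℕ, w l * ENNReal.ofReal (κ * Real.log l) =
          ENNReal.ofReal (1 / (2 * m) * κ) * ENNReal.ofReal (q l * l * Real.log l) := by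
        intro l
        rw [hw]
        simp only
        rw [← ENNReal.ofReal_mul (mul_nonneg hm0.le (mul_nonneg (by positivity) (hq_nonneg l))),
          ← ENNReal.ofReal_mul (by positivity)]
        congr 1
        ring
      simp only [this]
      rw [ENNReal.tsum_mul_left, hXlogX, ENNReal.mul_top]
      simp only [ne_eq, ENNReal.ofReal_eq_zero, not_le]
      positivity
    rw [h3, top_le_iff, ENNReal.add_eq_top] at h2
    exact h2.resolve_right hwfin
  obtain ⟨N, hN⟩ := eventually_atTop.1 hsecond
  have h4 := ENNReal.summable.sum_add_tsum_nat_add' (f := e) (k := N)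
  rw [hsumtop, ENNReal.add_eq_top] at h4
  have h5 := h4.resolve_left (by
    rw [ENNReal.sum_eq_top]; push Not; intro n _; exact ENNReal.ofReal_ne_top)
  rw [← top_le_iff, ← h5]
  refine (ENNReal.tsum_le_tsum fun n => hN (n + N) (by omega)).trans ?_
  exact ENNReal.tsum_comp_le_tsum_of_injective (add_left_injective N) _

end
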